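/- arXiv:2005.05907 — 2 statements merged into one kernel-verified Lean document; each statement's English description precedes it below -/
import Mathlib

section
/- Let a and b be two distinct letters. For all words v, w over {a, b}: if v·a·w belongs to the Kleene star of the set {a, bb, bbaba}, then v·a also belongs to the Kleene star of {a, bb, bbaba}. -/
/-- Kleene star of a language. -/
def kstarSet {σ : Type*} (L : Set (List σ)) : Set (List σ) :=
  {x | ∃ W : List (List σ), (∀ w ∈ W, w ∈ L) ∧ x = W.flatten}

theorem kstarSet_nil {σ : Type*} (L : Set (List σ)) : [] ∈ kstarSet L :=
  ⟨[], by simp, by simp⟩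

theorem append_mem_kstarSet {σ : Type*} {L : Set (List σ)} {u x : List σ}
    (hu : u ∈ L) (hx : x ∈ kstarSet L) : u ++ x ∈ kstarSet L := by
  obtain ⟨W, hW, rfl⟩ := hx
  exact ⟨u :: W, by simpa using ⟨hu, hW⟩, by simp⟩

theorem mem_kstarSet_of_append_singleton_append_eq_flatten {σ : Type*} {a b : σ} (hab : a ≠ b)
    (W : List (List σ))
    (hW : ∀ u ∈ W, u ∈ ({[a], [b, b], [b, b, a, b, a]} : Set (List σ)))
    (v w : List σ) (h : v ++ a :: w = W.flatten) :
    v ++ [a] ∈ kstarSet ({[a], [b, b], [b, b, a, b, a]} : Set (List σ)) := by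
  have ha : [a] ∈ ({[a], [b, b], [b, b, a, b, a]} : Set (List σ)) := by simp
  have hbb : [b, b] ∈ ({[a], [b, b], [b, b, a, b, a]} : Set (List σ)) := by simp
  have hbbaba : [b, b, a, b, a] ∈ ({[a], [b, b], [b, b, a, b, a]} : Set (List σ)) := by simp
  have h_nil := kstarSet_nil ({[a], [b, b], [b, b, a, b, a]} : Set (List σ))
  induction W generalizing v with
  | nil => simp at h
  | cons u W ih =>
    have ih' := ih fun x hx => hW x (List.mem_cons_of_mem _ hx)
    rcases hW u List.mem_cons_self with rfl | rfl | rfl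
    · rcases v with _ | ⟨x, v⟩
      · exact (append_mem_kstarSet ha h_nil :)
      · simp only [List.flatten_cons, List.cons_append, List.nil_append, List.cons.injEq] at h
        obtain ⟨rfl, h⟩ := h
        exact (append_mem_kstarSet ha (ih' v h) :)
    · rcases v with _ | ⟨x, _ | ⟨y, v⟩⟩ <;>
        simp only [List.flatten_cons, List.cons_append, List.nil_append, List.cons.injEq] at h
      · exact absurd h.1 hab
      · exact absurd h.2.1 hab
      · obtain ⟨rfl, rfl, h⟩ := h
        exact (append_mem_kstarSet hbb (ih' v h) :)
    · rcases v with _ | ⟨x, _ | ⟨y, _ | ⟨z, _ | ⟨s, _ | ⟨t, v⟩⟩⟩⟩⟩ <;>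
        simp only [List.flatten_cons, List.cons_append, List.nil_append, List.cons.injEq] at h
      · exact absurd h.1 hab
      · exact absurd h.2.1 hab
      · obtain ⟨rfl, rfl, -⟩ := h
        exact (append_mem_kstarSet hbb (append_mem_kstarSet ha h_nil) :)
      · exact absurd h.2.2.2.1 hab
      · obtain ⟨rfl, rfl, rfl, rfl, -⟩ := h
        exact (append_mem_kstarSet hbbaba h_nil :)
      · obtain ⟨rfl, rfl, rfl, rfl, rfl, h⟩ := h
        exact (append_mem_kstarSet hbbaba (ih' v h) :)

theorem stmt_13 {σ : Type*} (a b : σ) (hab : a ≠ b)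
    (v w : List σ)
    (hv : ∀ x ∈ v, x = a ∨ x = b) (hw : ∀ x ∈ w, x = a ∨ x = b)
    (h : v ++ [a] ++ w ∈ kstarSet ({[a], [b, b], [b, b, a, b, a]} : Set (List σ))) :
    v ++ [a] ∈ kstarSet ({[a], [b, b], [b, b, a, b, a]} : Set (List σ)) := by
  obtain ⟨W, hW, h⟩ := h
  exact mem_kstarSet_of_append_singleton_append_eq_flatten hab W hW v w (by simpa using h)
end

section
/- Let Σ = {a, b} with a ≠ b and let A = (Q, δ) be a deterministic complete semi-automaton over Σ having a sink state t (i.e., δ(t, a) = δ(t, b) = t). Define the deterministic complete semi-automaton A' over Σ with state set (Q × {1, 2}) ∪ {t'}, where t' is a new state, and transitions: δ'((q,1), a) = (q, 1); δ'((q,1), b) = (δ(q, b), 2); δ'((q,2), a) = (δ(q, a), 2); δ'((q,2), b) = (δ(q, b), 2) if δ(q, b) ≠ t and δ'((q,2), b) = t' if δ(q, b) = t; and δ'(t', a) = δ'(t', b) = t'. Then A has a synchronizing word in the language b·a·a*·b if and only if A' has a synchronizing word in the language b·a·a*·b·a*. -/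
/-- Extended transition function of a deterministic complete semi-automaton. -/
def run {Q σ : Type*} (δ : Q → σ → Q) (q : Q) (w : List σ) : Q := w.foldl δ q

/-- A word is synchronizing for the DCSA `(Q, δ)` if it maps every state to one state. -/
def IsSync {Q σ : Type*} (δ : Q → σ → Q) (w : List σ) : Prop := ∃ q, ∀ p, run δ p w = q

theorem run_append {Q σ : Type*} (δ : Q → σ → Q) (q : Q) (u v : List σ) :
    run δ q (u ++ v) = run δ (run δ q u) v := List.foldl_append

theorem run_cons {Q σ : Type*} (δ : Q → σ → Q) (q : Q) (x : σ) (v : List σ) :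
    run δ q (x :: v) = run δ (δ q x) v := rfl

theorem run_nil {Q σ : Type*} (δ : Q → σ → Q) (q : Q) : run δ q [] = q := rfl

theorem run_eq_of_sink {Q σ : Type*} {δ : Q → σ → Q} {t : Q} {w : List σ}
    (ht : ∀ x ∈ w, δ t x = t) : run δ t w = t := by
  induction w with
  | nil => rfl
  | cons x w ih =>
    rw [run_cons, ht x List.mem_cons_self]
    exact ih fun y hy => ht y (List.mem_cons_of_mem x hy)

/-- A map commuting with the action of a letter commutes with the action of its powers. -/
theorem run_replicate_semiconj {P Q σ : Type*} {δ : P → σ → P} {δ' : Q → σ → Q} {f : P → Q}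
    {x : σ} (h : ∀ p, δ' (f p) x = f (δ p x)) (n : ℕ) (p : P) :
    run δ' (f p) (List.replicate n x) = f (run δ p (List.replicate n x)) := by
  induction n generalizing p with
  | zero => rfl
  | succ n ih => rw [List.replicate_succ, run_cons, run_cons, h, ih]

theorem stmt_14 {σ : Type*} (a b : σ) (hab : a ≠ b) (hall : ∀ x : σ, x = a ∨ x = b)
    {Q : Type*} [Fintype Q] [Nonempty Q]
    (δ : Q → σ → Q) (t : Q) (hta : δ t a = t) (htb : δ t b = t)
    (δ' : Q × Bool ⊕ Unit → σ → Q × Bool ⊕ Unit)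
    (h1a : ∀ q : Q, δ' (Sum.inl (q, false)) a = Sum.inl (q, false))
    (h1b : ∀ q : Q, δ' (Sum.inl (q, false)) b = Sum.inl (δ q b, true))
    (h2a : ∀ q : Q, δ' (Sum.inl (q, true)) a = Sum.inl (δ q a, true))
    (h2b : ∀ q : Q, δ q b ≠ t → δ' (Sum.inl (q, true)) b = Sum.inl (δ q b, true))
    (h2b' : ∀ q : Q, δ q b = t → δ' (Sum.inl (q, true)) b = Sum.inr ())
    (ht' : ∀ x : σ, δ' (Sum.inr ()) x = Sum.inr ()) :
    (∃ w : List σ, (∃ n : ℕ, w = [b, a] ++ List.replicate n a ++ [b]) ∧ IsSync δ w) ↔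
    (∃ w : List σ,
        (∃ n m : ℕ, w = [b, a] ++ List.replicate n a ++ [b] ++ List.replicate m a) ∧
        IsSync δ' w) := by
  have hsink (w : List σ) : run δ t w = t :=
    run_eq_of_sink fun x _ => by rcases hall x with rfl | rfl <;> assumption
  have hsink' (w : List σ) : run δ' (Sum.inr ()) w = Sum.inr () :=
    run_eq_of_sink fun x _ => ht' x
  have hrep (n : ℕ) (q : Q) : run δ' (Sum.inl (q, true)) (List.replicate n a) =
      Sum.inl (run δ q (List.replicate n a), true) :=
    run_replicate_semiconj (f := fun q => Sum.inl (q, true)) h2a n q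
  constructor
  · rintro ⟨_, ⟨n, rfl⟩, r, hr⟩
    have hw (q : Q) : δ (run δ (δ (δ q b) a) (List.replicate n a)) b = t := by
      have := (hr q).trans ((hr t).symm.trans (hsink _))
      simpa [run_append, run_cons, run_nil] using this
    refine ⟨_, ⟨n, 0, rfl⟩, Sum.inr (), ?_⟩
    rintro (⟨q, _ | _⟩ | _)
    · simp [run_append, run_cons, run_nil, h1b, h2a, hrep, h2b' _ (hw q)]
    · by_cases hq : δ q b = t
      · simp [run_cons, h2b' _ hq, hsink']
      · simp [run_append, run_cons, run_nil, h2b _ hq, h2a, hrep, h2b' _ (hw q)]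
    · exact hsink' _
  · rintro ⟨_, ⟨n, m, rfl⟩, r, hr⟩
    refine ⟨_, ⟨n, rfl⟩, t, fun q => ?_⟩
    have hq := (hr (Sum.inl (q, false))).trans ((hr (Sum.inr ())).symm.trans (hsink' _))
    simp only [List.cons_append, List.nil_append, run_append, run_cons, run_nil, h1b, h2a,
      hrep] at hq ⊢
    by_contra hne
    rw [h2b _ hne, hrep] at hq
    exact Sum.inl_ne_inr hq
end
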